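/- The invariant F_N is unchanged under the special Kirby (+)-move on the linking matrix: for every m×m symmetric integer matrix A, F_N(A ⊕ (1)) = F_N(A), where A ⊕ (1) is the (m+1)×(m+1) block-diagonal matrix with blocks A and the 1×1 matrix (1). -/

import Mathlib

open Finset

noncomputable section

/-- `q = exp(2πi/N)`. -/
def qRoot (N : ℕ) : ℂ := Complex.exp (2 * Real.pi * Complex.I / N)

/-- The Gauss sum `G_k = Σ_{ν=0}^{N-1} q^{kν²}`. -/
def gauss (N : ℕ) (k : ℤ) : ℂ := ∑ ν ∈ range N, qRoot N ^ (k * (ν : ℤ) ^ 2)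

open scoped Classical in
/-- `σ(A)`: the number of nonpositive eigenvalues (with multiplicity) of the
symmetric integer matrix `A`, regarded as a real symmetric matrix. -/
def sigmaCount {n : Type*} [Fintype n] [DecidableEq n] (A : Matrix n n ℤ) : ℕ :=
  if h : (A.map (fun x : ℤ => (x : ℝ))).IsHermitian then
    (Finset.univ.filter fun i => h.eigenvalues i ≤ 0).card
  else 0

/-- The three-manifold invariant arising from `U_q(gl(2|1))` at `q = exp(2πi/N)`,
`N = 2r+1`, in the special case where only one-dimensional representations
contribute, as a function of the linking matrix `A` (of size `m = card n`):
`F_N(A) = N^{-m/2}·(G_{N-1}/√N)^{m-2σ(A)}·Σ_{x∈{0,…,N-1}^m} q^{xᵀAx}`. -/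
def FN (r : ℕ) {n : Type*} [Fintype n] [DecidableEq n] (A : Matrix n n ℤ) : ℂ :=
  ((Real.sqrt (2 * r + 1) : ℂ)) ^ (-(Fintype.card n : ℤ)) *
    (gauss (2 * r + 1) ((2 * r + 1 : ℤ) - 1) / (Real.sqrt (2 * r + 1) : ℂ)) ^
      ((Fintype.card n : ℤ) - 2 * (sigmaCount A : ℤ)) *
    ∑ x ∈ Fintype.piFinset (fun _ : n => Finset.range (2 * r + 1)),
      qRoot (2 * r + 1) ^ (∑ i, ∑ j, (x i : ℤ) * A i j * (x j : ℤ))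

/-- The number of nonpositive eigenvalues, read off from the roots of the characteristic
polynomial. -/
lemma sigmaCount_eq_countP_roots {n : Type*} [Fintype n] [DecidableEq n] {A : Matrix n n ℤ}
    (hA : A.IsSymm) :
    sigmaCount A =
      (A.map (fun x : ℤ => (x : ℝ))).charpoly.roots.countP (fun t : ℝ => t ≤ 0) := by
  have h : (A.map (fun x : ℤ => (x : ℝ))).IsHermitian := by
    ext i j
    simp [hA.apply i j]
  rw [sigmaCount, dif_pos h, h.roots_charpoly_eq_eigenvalues, Multiset.countP_map,
    Finset.card_def, Finset.filter_val]
  simp only [Function.comp_apply, RCLike.ofReal_real_eq_id, id_eq]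

/-- Adjoining a positive `1 × 1` block adds no nonpositive eigenvalue. -/
lemma sigmaCount_fromBlocks_one {n : Type*} [Fintype n] [DecidableEq n] {A : Matrix n n ℤ}
    (hA : A.IsSymm) :
    sigmaCount (Matrix.fromBlocks A 0 0 (1 : Matrix (Fin 1) (Fin 1) ℤ)) = sigmaCount A := by
  have hB : (Matrix.fromBlocks A 0 0 (1 : Matrix (Fin 1) (Fin 1) ℤ)).IsSymm :=
    hA.fromBlocks (by simp) Matrix.isSymm_one
  have hone : ((1 : Matrix (Fin 1) (Fin 1) ℤ).map (fun x : ℤ => (x : ℝ))) = 1 :=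
    Matrix.map_one _ (by simp) (by simp)
  rw [sigmaCount_eq_countP_roots hB, sigmaCount_eq_countP_roots hA, Matrix.fromBlocks_map, hone,
    Matrix.map_zero _ (by simp), Matrix.map_zero _ (by simp),
    Matrix.charpoly_fromBlocks_zero₁₂, Matrix.charpoly_one,
    Polynomial.roots_mul (mul_ne_zero (Matrix.charpoly_monic _).ne_zero
      (by simpa using Polynomial.X_sub_C_ne_zero (1 : ℝ))), Multiset.countP_add]
  have hroots : ((Polynomial.X - 1 : Polynomial ℝ)).roots = {1} := by
    simpa using Polynomial.roots_X_sub_C (1 : ℝ)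
  simp [hroots, Multiset.countP_eq_zero]

lemma qRoot_ne_zero (N : ℕ) : qRoot N ≠ 0 := Complex.exp_ne_zero _

lemma qRoot_zpow (N : ℕ) [NeZero N] (k : ℤ) : qRoot N ^ k = ZMod.stdAddChar (k : ZMod N) := by
  rw [ZMod.stdAddChar_coe, qRoot, ← Complex.exp_int_mul]
  congr 1
  ring

/-- The Gauss sum as a sum over `ℤ/N`. -/
lemma gauss_eq_sum_zmod (N : ℕ) [NeZero N] (k : ℤ) :
    gauss N k = ∑ x : ZMod N, ZMod.stdAddChar ((k : ZMod N) * x ^ 2) := by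
  refine Finset.sum_nbij' (fun ν : ℕ => (ν : ZMod N)) ZMod.val (by simp)
    (fun x _ => Finset.mem_range.2 x.val_lt)
    (fun ν hν => ZMod.val_cast_of_lt (Finset.mem_range.1 hν)) (by simp) fun ν _ => ?_
  rw [qRoot_zpow]
  push_cast
  rfl

/-- For odd `N`, the Gauss sums `G_{N-1}` and `G_1` multiply to `N`. -/
lemma gauss_sub_one_mul_gauss_one {N : ℕ} (hN : Odd N) :
    gauss N ((N : ℤ) - 1) * gauss N 1 = N := by
  have : NeZero N := ⟨hN.pos.ne'⟩
  have htwo : IsUnit (2 : ZMod N) := by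
    have := (ZMod.isUnit_iff_coprime 2 N).2 (Nat.coprime_two_left.2 hN)
    exact_mod_cast this
  rw [gauss_eq_sum_zmod, gauss_eq_sum_zmod, Finset.sum_mul_sum]
  calc ∑ y : ZMod N, ∑ x : ZMod N,
        ZMod.stdAddChar ((((N : ℤ) - 1 : ℤ) : ZMod N) * y ^ 2) *
          ZMod.stdAddChar (((1 : ℤ) : ZMod N) * x ^ 2)
      = ∑ y : ZMod N, ∑ d : ZMod N,
          (ZMod.stdAddChar (d ^ 2) * ZMod.stdAddChar (y * (2 * d)) : ℂ) := by
        refine Finset.sum_congr rfl fun y _ => ?_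
        refine (Fintype.sum_equiv (Equiv.addLeft y) _ _ fun d => ?_).symm
        simp only [← AddChar.map_add_eq_mul, Equiv.coe_addLeft]
        congr 1
        push_cast
        rw [ZMod.natCast_self]
        ring
    _ = ∑ d : ZMod N, (ZMod.stdAddChar (d ^ 2) : ℂ) * (if d = 0 then (N : ℂ) else 0) := by
        rw [Finset.sum_comm]
        refine Finset.sum_congr rfl fun d _ => ?_
        rw [← Finset.mul_sum, AddChar.sum_mulShift _ (ZMod.isPrimitive_stdAddChar N)]
        simp [htwo.mul_right_eq_zero, ZMod.card]
    _ = N := by simp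

/-- The quadratic exponential sum of `A ⊕ (1)` factors. -/
lemma sum_qRoot_fromBlocks_one {n : Type*} [Fintype n] [DecidableEq n] (N : ℕ)
    (A : Matrix n n ℤ) :
    ∑ x ∈ Fintype.piFinset (fun _ : n ⊕ Fin 1 => Finset.range N),
        qRoot N ^ (∑ i, ∑ j, (x i : ℤ) *
          Matrix.fromBlocks A 0 0 (1 : Matrix (Fin 1) (Fin 1) ℤ) i j * (x j : ℤ)) =
      (∑ x ∈ Fintype.piFinset (fun _ : n => Finset.range N),
        qRoot N ^ (∑ i, ∑ j, (x i : ℤ) * A i j * (x j : ℤ))) * gauss N 1 := by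
  rw [gauss, Finset.sum_mul_sum, ← Finset.sum_product']
  refine Finset.sum_nbij' (fun x => (x ∘ Sum.inl, x (Sum.inr 0)))
    (fun p => Sum.elim p.1 fun _ => p.2) ?_ ?_ ?_ ?_ ?_
  · intro x hx
    simp_all
  · rintro ⟨y, ν⟩ h
    simpa using h
  · intro x _
    ext (i | i)
    · rfl
    · simp [Subsingleton.elim i 0]
  · rintro ⟨y, ν⟩ _
    rfl
  · intro x _
    rw [← zpow_add₀ (qRoot_ne_zero N)]
    simp [Fintype.sum_sum_type, sq]

/-- `F_N` is unchanged under the special Kirby `(+)`-move on the linking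
matrix: `F_N(A ⊕ (1)) = F_N(A)` for every symmetric integer matrix `A`. -/
theorem FN_kirby_plus (r : ℕ) (hr : 1 ≤ r) {m : ℕ}
    (A : Matrix (Fin m) (Fin m) ℤ) (hA : A.IsSymm) :
    FN r (Matrix.fromBlocks A 0 0 (1 : Matrix (Fin 1) (Fin 1) ℤ)) = FN r A := by
  have hs : (Real.sqrt (2 * r + 1) : ℂ) ≠ 0 := by
    have : (0 : ℝ) < 2 * r + 1 := by positivity
    exact_mod_cast (Real.sqrt_pos.2 this).ne'
  have hsq : (Real.sqrt (2 * r + 1) : ℂ) * Real.sqrt (2 * r + 1) = 2 * r + 1 := by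
    have : (0 : ℝ) ≤ 2 * r + 1 := by positivity
    exact_mod_cast Real.mul_self_sqrt this
  have hG : gauss (2 * r + 1) ((2 * r + 1 : ℤ) - 1) * gauss (2 * r + 1) 1 = 2 * r + 1 := by
    simpa using gauss_sub_one_mul_gauss_one (odd_two_mul_add_one r)
  have hG0 : gauss (2 * r + 1) ((2 * r + 1 : ℤ) - 1) ≠ 0 := by
    refine left_ne_zero_of_mul (b := gauss (2 * r + 1) 1) ?_
    rw [hG, ← hsq]
    exact mul_ne_zero hs hs
  rw [FN, FN, sigmaCount_fromBlocks_one hA, sum_qRoot_fromBlocks_one]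
  simp only [Fintype.card_sum, Fintype.card_fin, Nat.cast_add, Nat.cast_one]
  set s : ℂ := (Real.sqrt (2 * r + 1) : ℂ)
  set G := gauss (2 * r + 1) ((2 * r + 1 : ℤ) - 1)
  rw [show (-((m : ℤ) + 1)) = -(m : ℤ) + -1 by ring,
    show (m : ℤ) + 1 - 2 * (sigmaCount A : ℤ) = ((m : ℤ) - 2 * (sigmaCount A : ℤ)) + 1 by ring,
    zpow_add₀ hs, zpow_add₀ (div_ne_zero hG0 hs), zpow_one, zpow_neg_one]
  have hunit : s⁻¹ * (G / s) * gauss (2 * r + 1) 1 = 1 := by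
    rw [← hsq] at hG
    field_simp
    rw [hG, sq]
  linear_combination (s ^ (-(m : ℤ)) * (G / s) ^ ((m : ℤ) - 2 * (sigmaCount A : ℤ)) *
    ∑ x ∈ Fintype.piFinset (fun _ : Fin m => Finset.range (2 * r + 1)),
      qRoot (2 * r + 1) ^ (∑ i, ∑ j, (x i : ℤ) * A i j * (x j : ℤ))) * hunit

end
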